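/- arXiv:2008.05278 — 3 statements merged into one kernel-verified Lean document; each statement's English description precedes it below -/
import Mathlib

section
/- Let H be a Hermitian d×d complex matrix and σ a density matrix (positive semidefinite Hermitian d×d complex matrix of trace one). Then there exists a unitary d×d matrix V such that Re Tr[H V σ V*] = inf over unitary d×d matrices U of Re Tr[U* H U σ]; consequently the state V σ V* is passive, i.e. its ergotropy vanishes: R_H(V σ V*) = 0, where R_H(χ) := Re Tr[Hχ] − inf over unitaries U of Re Tr[U* H U χ]. -/
open Matrix
open scoped ComplexOrder

/-- A density matrix: positive semidefinite (hence Hermitian) with unit trace. -/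
def IsDensityMatrix {ι : Type} [Fintype ι] (χ : Matrix ι ι ℂ) : Prop :=
  χ.PosSemidef ∧ χ.trace = 1

/-- The passive energy `P_H(χ) = inf_U Re Tr[U* H U χ]` over unitaries `U`. -/
noncomputable def passiveEnergy {ι : Type} [Fintype ι] [DecidableEq ι]
    (H χ : Matrix ι ι ℂ) : ℝ :=
  ⨅ U : Matrix.unitaryGroup ι ℂ,
    (((U : Matrix ι ι ℂ)ᴴ * H * (U : Matrix ι ι ℂ) * χ).trace).re

/-- The ergotropy `R_H(χ) = Re Tr[H χ] - P_H(χ)`. -/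
noncomputable def ergotropy {ι : Type} [Fintype ι] [DecidableEq ι]
    (H χ : Matrix ι ι ℂ) : ℝ :=
  ((H * χ).trace).re - passiveEnergy H χ

/-- The unitary group of complex matrices is compact. -/
theorem compactSpace_unitaryGroup (ι : Type*) [Fintype ι] [DecidableEq ι] :
    CompactSpace (Matrix.unitaryGroup ι ℂ) := by
  have hK : IsCompact {A : Matrix ι ι ℂ | ∀ i, A i ∈ {v : ι → ℂ | ∀ j, v j ∈
      Metric.closedBall (0 : ℂ) 1}} :=
    isCompact_pi_infinite fun _ => isCompact_pi_infinite fun _ => isCompact_closedBall 0 1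
  refine isCompact_iff_compactSpace.mp (hK.of_isClosed_subset isClosed_unitary ?_)
  intro U hU i j
  simpa using entry_norm_bound_of_unitary hU i j

/-- The passive energy is attained at some unitary. -/
theorem exists_eq_passiveEnergy {ι : Type} [Fintype ι] [DecidableEq ι] (H χ : Matrix ι ι ℂ) :
    ∃ V : Matrix.unitaryGroup ι ℂ,
      (((V : Matrix ι ι ℂ)ᴴ * H * (V : Matrix ι ι ℂ) * χ).trace).re = passiveEnergy H χ := by
  have := compactSpace_unitaryGroup ι
  have hf : Continuous fun U : Matrix.unitaryGroup ι ℂ =>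
      (((U : Matrix ι ι ℂ)ᴴ * H * (U : Matrix ι ι ℂ) * χ).trace).re := by
    fun_prop
  exact (isCompact_range hf).sInf_mem (Set.range_nonempty _)

theorem trace_mul_conj {ι : Type*} [Fintype ι] (H V χ : Matrix ι ι ℂ) :
    (H * (V * χ * Vᴴ)).trace = (Vᴴ * H * V * χ).trace := by
  rw [← Matrix.mul_assoc, Matrix.trace_mul_comm]
  simp only [Matrix.mul_assoc]

/-- The passive energy is constant on unitary orbits. -/
theorem passiveEnergy_unitary_conj {ι : Type} [Fintype ι] [DecidableEq ι] (H χ : Matrix ι ι ℂ)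
    (V : Matrix.unitaryGroup ι ℂ) :
    passiveEnergy H ((V : Matrix ι ι ℂ) * χ * (V : Matrix ι ι ℂ)ᴴ) = passiveEnergy H χ := by
  refine (Equiv.mulRight V).iInf_congr fun U => ?_
  simp only [Equiv.coe_mulRight, Submonoid.coe_mul, Matrix.conjTranspose_mul]
  rw [trace_mul_conj]
  simp only [Matrix.mul_assoc]

/-- Any state can be unitarily transformed into a passive state: there is a unitary `V`
achieving the passive energy, and the resulting state `V σ V*` has zero ergotropy. -/
theorem exists_unitary_to_passive_state {d : ℕ}
    (H σ : Matrix (Fin d) (Fin d) ℂ) (hH : H.IsHermitian) (hσ : IsDensityMatrix σ) :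
    ∃ V : Matrix.unitaryGroup (Fin d) ℂ,
      ((H * ((V : Matrix (Fin d) (Fin d) ℂ) * σ * (V : Matrix (Fin d) (Fin d) ℂ)ᴴ)).trace).re
          = passiveEnergy H σ ∧
      ergotropy H ((V : Matrix (Fin d) (Fin d) ℂ) * σ * (V : Matrix (Fin d) (Fin d) ℂ)ᴴ) = 0 := by
  obtain ⟨V, hV⟩ := exists_eq_passiveEnergy H σ
  have hE : ((H * ((V : Matrix (Fin d) (Fin d) ℂ) * σ * (V : Matrix (Fin d) (Fin d) ℂ)ᴴ)).trace).re
      = passiveEnergy H σ := by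
    rw [trace_mul_conj, hV]
  exact ⟨V, hE, by rw [ergotropy, passiveEnergy_unitary_conj, hE, sub_self]⟩
end

section
/- Let H be a Hermitian d×d complex matrix and ρ a density matrix (positive semidefinite Hermitian d×d complex matrix of trace one). Let λ_0 ≤ λ_1 ≤ … ≤ λ_{d−1} be the eigenvalues of H sorted in increasing order and p_0 ≥ p_1 ≥ … ≥ p_{d−1} the eigenvalues of ρ sorted in decreasing order. Then the passive energy equals the oppositely ordered pairing: inf over unitary d×d matrices U of Re Tr[U* H U ρ] = Σ_{i=0}^{d−1} λ_i · p_i. -/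
open Matrix
open scoped ComplexOrder

namespace Matrix

variable {n : Type*} [Fintype n] [DecidableEq n]

/-- A Hermitian matrix is unitarily similar to the diagonal matrix of its eigenvalues, listed in
any order. -/
theorem IsHermitian.exists_unitary_conj_diagonal {A : Matrix n n ℂ} (hA : A.IsHermitian)
    (e : Equiv.Perm n) :
    ∃ V : unitaryGroup n ℂ,
      A = V * diagonal (fun i => ((hA.eigenvalues ∘ e) i : ℂ)) * (V : Matrix n n ℂ)ᴴ := by
  let W : Matrix n n ℂ := hA.eigenvectorUnitary.1
  have hV : W.submatrix id e ∈ unitaryGroup n ℂ := by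
    rw [mem_unitaryGroup_iff, star_eq_conjTranspose, conjTranspose_submatrix,
      submatrix_mul_equiv, submatrix_id_id]
    exact mem_unitaryGroup_iff.1 hA.eigenvectorUnitary.2
  refine ⟨⟨_, hV⟩, ?_⟩
  have hD : diagonal (fun i => ((hA.eigenvalues ∘ e) i : ℂ)) =
      (diagonal (RCLike.ofReal ∘ hA.eigenvalues) : Matrix n n ℂ).submatrix e e := by
    rw [submatrix_diagonal_equiv]
    rfl
  rw [hD, conjTranspose_submatrix, submatrix_mul_equiv, submatrix_mul_equiv, submatrix_id_id]
  exact hA.spectral_theorem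

/-- The squared moduli of the entries of a unitary matrix form a doubly stochastic matrix. -/
theorem map_normSq_mem_doublyStochastic {T : Matrix n n ℂ} (hT : T ∈ unitaryGroup n ℂ) :
    T.map Complex.normSq ∈ doublyStochastic ℝ n := by
  rw [mem_doublyStochastic_iff_sum]
  refine ⟨fun i j => Complex.normSq_nonneg _, fun i => ?_, fun j => ?_⟩
  · have h := congrFun₂ (mem_unitaryGroup_iff.1 hT) i i
    simp only [mul_apply, star_apply, RCLike.star_def, Complex.mul_conj, one_apply_eq] at h
    exact_mod_cast h
  · have h := congrFun₂ (mem_unitaryGroup_iff'.1 hT) j j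
    simp only [mul_apply, star_apply, RCLike.star_def, ← Complex.normSq_eq_conj_mul_self,
      one_apply_eq] at h
    exact_mod_cast h

theorem trace_conj_diagonal_mul_diagonal (T : Matrix n n ℂ) (f g : n → ℝ) :
    (Tᴴ * diagonal (fun i => (f i : ℂ)) * T * diagonal (fun i => (g i : ℂ))).trace.re =
      f ⬝ᵥ (T.map Complex.normSq *ᵥ g) := by
  have h : (Tᴴ * diagonal (fun i => (f i : ℂ)) * T * diagonal (fun i => (g i : ℂ))).trace =
      ((f ⬝ᵥ (T.map Complex.normSq *ᵥ g) : ℝ) : ℂ) := by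
    simp only [trace, diag_apply, mul_diagonal, mul_apply (M := Tᴴ * _), conjTranspose_apply,
      dotProduct, mulVec, map_apply, Finset.mul_sum, Finset.sum_mul]
    rw [Finset.sum_comm]
    push_cast
    refine Finset.sum_congr rfl fun i _ => Finset.sum_congr rfl fun j _ => ?_
    rw [Complex.normSq_eq_conj_mul_self, RCLike.star_def]
    ring
  rw [h, Complex.ofReal_re]

end Matrix

/-- Averaging over a doubly stochastic matrix cannot decrease below the antivarying pairing. -/
theorem Antivary.dotProduct_le_dotProduct_mulVec {n : Type*} [Fintype n] [DecidableEq n]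
    {f g : n → ℝ} (hfg : Antivary f g) {M : Matrix n n ℝ} (hM : M ∈ doublyStochastic ℝ n) :
    f ⬝ᵥ g ≤ f ⬝ᵥ (M *ᵥ g) := by
  obtain ⟨w, hw, hw_sum, rfl⟩ := exists_eq_sum_perm_of_mem_doublyStochastic hM
  simp only [sum_mulVec, smul_mulVec, permMatrix_mulVec, dotProduct_sum, dotProduct_smul,
    smul_eq_mul]
  calc f ⬝ᵥ g = ∑ σ, w σ * (f ⬝ᵥ g) := by rw [← Finset.sum_mul, hw_sum, one_mul]
    _ ≤ ∑ σ, w σ * (f ⬝ᵥ (g ∘ σ)) := by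
      gcongr with σ
      · exact hw σ
      · exact hfg.sum_mul_le_sum_mul_comp_perm

/-- The passive energy equals the oppositely ordered pairing of the spectra:
if `lam` lists the eigenvalues of `H` in increasing order and `p` lists the eigenvalues
of `ρ` in decreasing order, then `inf_U Re Tr[U* H U ρ] = Σ i, lam i * p i`. -/
theorem passiveEnergy_eq_antitone_pairing {d : ℕ}
    (H ρ : Matrix (Fin d) (Fin d) ℂ) (hH : H.IsHermitian) (hρ : IsDensityMatrix ρ)
    (lam p : Fin d → ℝ)
    (hlam_mono : Monotone lam)
    (hlam_eig : ∃ e : Equiv.Perm (Fin d), lam = hH.eigenvalues ∘ e)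
    (hp_anti : Antitone p)
    (hp_eig : ∃ e : Equiv.Perm (Fin d), p = hρ.1.1.eigenvalues ∘ e) :
    passiveEnergy H ρ = ∑ i, lam i * p i := by
  obtain ⟨e, he⟩ := hlam_eig
  obtain ⟨e', he'⟩ := hp_eig
  obtain ⟨V, hV⟩ := hH.exists_unitary_conj_diagonal e
  obtain ⟨W, hW⟩ := hρ.1.1.exists_unitary_conj_diagonal e'
  rw [← he] at hV
  rw [← he'] at hW
  have key (U : unitaryGroup (Fin d) ℂ) :
      ((U : Matrix (Fin d) (Fin d) ℂ)ᴴ * H * U * ρ).trace.re =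
        lam ⬝ᵥ ((((star V * U * W : unitaryGroup (Fin d) ℂ) : Matrix (Fin d) (Fin d) ℂ).map
          Complex.normSq) *ᵥ p) := by
    rw [← trace_conj_diagonal_mul_diagonal, hV, hW, ← Matrix.mul_assoc, trace_mul_comm]
    simp [star_eq_conjTranspose, Matrix.mul_assoc]
  unfold passiveEnergy
  simp only [key]
  have hanti : Antivary lam p := hlam_mono.antivary hp_anti
  have hle (U : unitaryGroup (Fin d) ℂ) := hanti.dotProduct_le_dotProduct_mulVec
    (map_normSq_mem_doublyStochastic (star V * U * W).2)
  refine le_antisymm ((ciInf_le ⟨_, Set.forall_mem_range.2 hle⟩ (V * star W)).trans_eq ?_)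
    (le_ciInf hle)
  have hone : star V * (V * star W) * W = 1 := by
    rw [← mul_assoc, Unitary.star_mul_self, one_mul, Unitary.star_mul_self]
  rw [hone, OneMemClass.coe_one, Matrix.map_one _ (map_zero _) (map_one _), one_mulVec]
  rfl
end

section
/- Let H be a Hermitian d×d complex matrix, χ a density matrix on ℂ^d, μ a probability measure on ℝ, and W : ℝ → (d×d complex matrices) a continuous map such that W(t) is unitary for every t. Then the passive energy does not decrease under mixing of unitary conjugates: inf over unitary d×d matrices V of Re Tr[V* H V (∫ W(t) χ W(t)* dμ(t))] ≥ inf over unitary d×d matrices V of Re Tr[V* H V χ], where the integral is a Bochner integral of matrix-valued functions. -/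
open Matrix MeasureTheory
open scoped ComplexOrder

attribute [local instance] Matrix.normedAddCommGroup Matrix.normedSpace

theorem MeasureTheory.integrable_and_map_integral_of_continuous_of_bound {α E : Type*}
    [TopologicalSpace α] [SecondCountableTopology α] [MeasurableSpace α]
    [OpensMeasurableSpace α] {μ : Measure α} [IsFiniteMeasure μ]
    [NormedAddCommGroup E] [NormedSpace ℝ E] [FiniteDimensional ℝ E]
    {X : α → E} (hX : Continuous X) {C : ℝ} (hC : ∀ t, ‖X t‖ ≤ C) (L : E →ₗ[ℝ] ℝ) :
    Integrable (fun t => L (X t)) μ ∧ L (∫ t, X t ∂μ) = ∫ t, L (X t) ∂μ := by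
  have : CompleteSpace E := FiniteDimensional.complete ℝ E
  have hint : Integrable X μ :=
    Integrable.of_bound hX.aestronglyMeasurable C (ae_of_all _ hC)
  exact ⟨L.toContinuousLinearMap.integrable_comp hint,
    (L.toContinuousLinearMap.integral_comp_comm hint).symm⟩

theorem Matrix.exists_norm_le_on_unitaryGroup {ι E : Type*} [Fintype ι] [DecidableEq ι]
    [SeminormedAddCommGroup E] {f : Matrix ι ι ℂ → E} (hf : Continuous f) :
    ∃ C : ℝ, ∀ U ∈ Matrix.unitaryGroup ι ℂ, ‖f U‖ ≤ C := by
  have hcompact : IsCompact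
      (Set.univ.pi fun _ : ι => Set.univ.pi fun _ : ι => Metric.closedBall (0 : ℂ) 1) :=
    isCompact_univ_pi fun _ => isCompact_univ_pi fun _ => isCompact_closedBall _ _
  obtain ⟨C, hC⟩ := hcompact.exists_bound_of_continuousOn (f := f) hf.continuousOn
  exact ⟨C, fun U hU => hC U fun i _ j _ => by
    simpa using entry_norm_bound_of_unitary hU i j⟩

theorem passiveEnergy_le {ι : Type} [Fintype ι] [DecidableEq ι]
    (H χ : Matrix ι ι ℂ) (U : Matrix.unitaryGroup ι ℂ) :
    passiveEnergy H χ ≤ (((U : Matrix ι ι ℂ)ᴴ * H * (U : Matrix ι ι ℂ) * χ).trace).re := by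
  have hcont : Continuous fun M : Matrix ι ι ℂ => ((Mᴴ * H * M * χ).trace).re :=
    Complex.continuous_re.comp ((((continuous_id.matrix_conjTranspose.matrix_mul
      continuous_const).matrix_mul continuous_id).matrix_mul continuous_const).matrix_trace)
  obtain ⟨C, hC⟩ := Matrix.exists_norm_le_on_unitaryGroup hcont
  refine ciInf_le ⟨-C, ?_⟩ U
  rintro _ ⟨V, rfl⟩
  exact (abs_le.mp (hC V V.2)).1

theorem Matrix.exists_norm_unitary_conj_le {ι : Type*} [Fintype ι] [DecidableEq ι]
    (χ : Matrix ι ι ℂ) :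
    ∃ C : ℝ, ∀ U ∈ Matrix.unitaryGroup ι ℂ, ‖U * χ * Uᴴ‖ ≤ C :=
  Matrix.exists_norm_le_on_unitaryGroup (f := fun U => U * χ * Uᴴ)
    ((continuous_id.matrix_mul continuous_const).matrix_mul continuous_id.matrix_conjTranspose)

/-- The real-linear functional `X ↦ Re Tr[A X]`. -/
noncomputable def Matrix.reTraceMulLeft {ι : Type*} [Fintype ι] (A : Matrix ι ι ℂ) :
    Matrix ι ι ℂ →ₗ[ℝ] ℝ where
  toFun X := ((A * X).trace).re
  map_add' := by simp [Matrix.mul_add]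
  map_smul' := by simp

/-- The passive energy does not decrease under mixing of unitary conjugates. -/
theorem passiveEnergy_le_passiveEnergy_mix {d : ℕ}
    (H χ : Matrix (Fin d) (Fin d) ℂ) (hH : H.IsHermitian) (hχ : IsDensityMatrix χ)
    (μ : Measure ℝ) [IsProbabilityMeasure μ]
    (W : ℝ → Matrix (Fin d) (Fin d) ℂ)
    (hWcont : Continuous W)
    (hWunitary : ∀ t : ℝ, W t ∈ Matrix.unitaryGroup (Fin d) ℂ) :
    passiveEnergy H χ ≤
      passiveEnergy H (∫ t : ℝ, W t * χ * (W t)ᴴ ∂μ) := by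
  have hcont : Continuous fun t => W t * χ * (W t)ᴴ :=
    (hWcont.matrix_mul continuous_const).matrix_mul hWcont.matrix_conjTranspose
  obtain ⟨C, hC⟩ := Matrix.exists_norm_unitary_conj_le χ
  refine le_ciInf fun U => ?_
  let A := (U : Matrix (Fin d) (Fin d) ℂ)ᴴ * H * (U : Matrix (Fin d) (Fin d) ℂ)
  have hpoint (t : ℝ) :
      passiveEnergy H χ ≤ A.reTraceMulLeft (W t * χ * (W t)ᴴ) := by
    refine (passiveEnergy_le H χ (U * ⟨W t, hWunitary t⟩)).trans_eq (congrArg Complex.re ?_)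
    rw [← Matrix.mul_assoc A, Matrix.trace_mul_comm (A * (W t * χ))]
    simp only [A, Submonoid.coe_mul, Matrix.conjTranspose_mul, Matrix.mul_assoc]
  obtain ⟨hint, heq⟩ := integrable_and_map_integral_of_continuous_of_bound (μ := μ)
    hcont (fun t => hC _ (hWunitary t)) A.reTraceMulLeft
  calc
    passiveEnergy H χ ≤ ∫ t, A.reTraceMulLeft (W t * χ * (W t)ᴴ) ∂μ := by
      simpa using integral_mono (integrable_const (passiveEnergy H χ)) hint hpoint
    _ = A.reTraceMulLeft (∫ t, W t * χ * (W t)ᴴ ∂μ) := heq.symm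
end
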